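/- arXiv:1601.05123 — 2 statements merged into one kernel-verified Lean document; each statement's English description precedes it below -/
import Mathlib

section
/- For every ε > 0 there exists a constant C > 0 such that for every prime p, all integers K, L, M, N ≥ 1 for which the intervals I = [K+1, K+M] and J = [L+1, L+N] are contained in [1, p-1], one has |∑_{m∈I} ∑_{n∈J} K_p(mn, 1)| ≤ C (p + MN) p^ε. -/
/-- `e_p(z) = exp(2πiz/p)`. -/
noncomputable def ep (p : ℕ) (z : ℤ) : ℂ := Complex.exp (2 * Real.pi * Complex.I * z / p)

/-- the multiplicative inverse of `x` modulo `p`, as a natural number -/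
def pinv (p x : ℕ) : ℕ := ((x : ZMod p)⁻¹).val

/-- the Kloosterman sum `K_p(m,n) = ∑_{x=1}^{p-1} e_p(m x + n x̄)` -/
noncomputable def Kl (p : ℕ) (m n : ℤ) : ℂ :=
  ∑ x ∈ Finset.Icc 1 (p - 1), ep p (m * x + n * (pinv p x : ℤ))

/-- The divisor bound: the number of divisors of `n` is `O(n ^ ε)` for every `ε > 0`. -/
theorem exists_card_divisors_le_mul_rpow {ε : ℝ} (hε : 0 < ε) :
    ∃ C : ℝ, 0 < C ∧ ∀ n : ℕ, n ≠ 0 → (n.divisors.card : ℝ) ≤ C * (n : ℝ) ^ ε := by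
  have hlog : 0 < Real.log 2 := Real.log_pos (by norm_num)
  set c : ℝ := 1 + 1 / (ε * Real.log 2) with hc
  have hc1 : 1 ≤ c := by rw [hc]; linarith [show 0 < 1 / (ε * Real.log 2) by positivity]
  set B : ℕ := ⌈(2 : ℝ) ^ (1 / ε)⌉₊ with hB
  refine ⟨c ^ B, by positivity, fun n hn => ?_⟩
  have hterm : ∀ q ∈ n.primeFactors, ((n.factorization q + 1 : ℕ) : ℝ) ≤
      (if q < B then c else 1) * ((q : ℝ) ^ n.factorization q) ^ ε := by
    intro q hq
    have hq2 : (2 : ℝ) ≤ q := by exact_mod_cast (Nat.prime_of_mem_primeFactors hq).two_le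
    generalize n.factorization q = a
    rw [← Real.rpow_natCast, ← Real.rpow_mul (by positivity), mul_comm (a : ℝ) ε,
      Real.rpow_mul (by positivity), Real.rpow_natCast]
    split_ifs with h
    · have h1 : 1 + a * (ε * Real.log 2) ≤ ((2 : ℝ) ^ ε) ^ a := by
        rw [← Real.rpow_natCast, ← Real.rpow_mul (by norm_num), Real.rpow_def_of_pos (by norm_num)]
        have := Real.add_one_le_exp (Real.log 2 * (ε * a))
        linarith
      have h2 : ((2 : ℝ) ^ ε) ^ a ≤ ((q : ℝ) ^ ε) ^ a := by gcongr
      have h3 : (a : ℝ) + 1 ≤ c * (1 + a * (ε * Real.log 2)) := by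
        have : c * (1 + a * (ε * Real.log 2)) =
            1 + a + 1 / (ε * Real.log 2) + a * (ε * Real.log 2) := by
          rw [hc]; field_simp; ring
        rw [this]
        have : 0 ≤ 1 / (ε * Real.log 2) + a * (ε * Real.log 2) := by positivity
        linarith
      push_cast
      calc (a : ℝ) + 1 ≤ c * (1 + a * (ε * Real.log 2)) := h3
        _ ≤ c * ((q : ℝ) ^ ε) ^ a := by gcongr; exact h1.trans h2
    · rw [one_mul]
      have h1 : (2 : ℝ) ^ (1 / ε) ≤ q := (Nat.le_ceil _).trans (by exact_mod_cast not_lt.1 h)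
      have h2 : (2 : ℝ) ≤ (q : ℝ) ^ ε := by
        calc (2 : ℝ) = ((2 : ℝ) ^ (1 / ε)) ^ ε := by
              rw [← Real.rpow_mul (by norm_num), one_div_mul_cancel hε.ne', Real.rpow_one]
          _ ≤ _ := by gcongr
      calc ((a + 1 : ℕ) : ℝ) ≤ 2 ^ a := by exact_mod_cast Nat.lt_two_pow_self
        _ ≤ _ := by gcongr
  have hprod : ∏ q ∈ n.primeFactors, ((q : ℝ) ^ n.factorization q) ^ ε = (n : ℝ) ^ ε := by
    rw [Real.finsetProd_rpow _ _ (fun _ _ => by positivity)]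
    congr 1
    exact_mod_cast Nat.prod_factorization_pow_eq_self hn
  have hsmall : ∏ q ∈ n.primeFactors, (if q < B then c else 1) ≤ c ^ B := by
    rw [← Finset.prod_filter, Finset.prod_const]
    refine pow_le_pow_right₀ hc1 ?_
    calc _ ≤ (Finset.range B).card := Finset.card_le_card fun q hq => by
          simpa using (Finset.mem_filter.1 hq).2
      _ = B := Finset.card_range B
  rw [Nat.card_divisors hn, Nat.cast_prod]
  calc _ ≤ _ := Finset.prod_le_prod (fun _ _ => by positivity) hterm
    _ ≤ _ := by
      rw [Finset.prod_mul_distrib, hprod]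
      gcongr

/-- A sum of additive characters over an interval is `O(1 / ‖x / p‖)`. -/
theorem norm_sum_stdAddChar_le {p : ℕ} [NeZero p] (x : ZMod p) (hx : x ≠ 0) (L N : ℕ) :
    ‖∑ n ∈ Finset.Icc (L + 1) (L + N), ZMod.stdAddChar ((n : ZMod p) * x)‖ ≤
      p / |(x.valMinAbs : ℝ)| := by
  set z : ℂ := ZMod.stdAddChar x with hz
  set a := x.valMinAbs with ha
  have hp : (0 : ℝ) < p := by exact_mod_cast NeZero.pos p
  have ha0 : 0 < |(a : ℝ)| := by simpa [ha] using hx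
  have hz1 : ‖z‖ = 1 := by rw [hz]; exact AddChar.norm_apply _ _
  have ha2 : |(a : ℝ)| ≤ p / 2 := by
    have := ZMod.natAbs_valMinAbs_le x
    have h2 : ((a.natAbs * 2 : ℕ) : ℝ) ≤ p := by exact_mod_cast (by omega)
    push_cast [Nat.cast_natAbs] at h2
    linarith
  have hlow : 4 * |(a : ℝ)| / p ≤ ‖z - 1‖ := by
    have hexp : z = Complex.exp (Complex.I * ((2 * Real.pi * a / p : ℝ) : ℂ)) := by
      rw [hz, ← ZMod.coe_valMinAbs x, ZMod.stdAddChar_coe]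
      congr 1
      push_cast
      ring
    rw [hexp, Complex.norm_exp_I_mul_ofReal_sub_one, norm_mul, Real.norm_eq_abs, Real.norm_eq_abs]
    have h := Real.mul_abs_le_abs_sin (x := 2 * Real.pi * a / p / 2) (by
      rw [show 2 * Real.pi * a / p / 2 = Real.pi / p * a by ring, abs_mul,
        abs_of_pos (by positivity : 0 < Real.pi / p)]
      calc Real.pi / p * |(a : ℝ)| ≤ Real.pi / p * (p / 2) := by gcongr
        _ = Real.pi / 2 := by field_simp)
    rw [show 2 * Real.pi * a / p / 2 = Real.pi / p * a by ring, abs_mul,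
        abs_of_pos (by positivity : 0 < Real.pi / p)] at h
    rw [show 2 * Real.pi * a / p / 2 = Real.pi / p * a by ring, abs_two]
    calc 4 * |(a : ℝ)| / p = 2 * (2 / Real.pi * (Real.pi / p * |(a : ℝ)|)) := by
          field_simp; ring
      _ ≤ _ := by gcongr
  have hsum : ∑ n ∈ Finset.Icc (L + 1) (L + N), ZMod.stdAddChar ((n : ZMod p) * x) =
      ∑ n ∈ Finset.Ico (L + 1) (L + N + 1), z ^ n := by
    refine Finset.sum_congr (by ext; simp) fun n _ => ?_
    rw [← nsmul_eq_mul, AddChar.map_nsmul_eq_pow]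
  have hgeom : (∑ n ∈ Finset.Ico (L + 1) (L + N + 1), z ^ n) * (z - 1) =
      z ^ (L + N + 1) - z ^ (L + 1) := geom_sum_Ico_mul z (by omega)
  have hub : ‖∑ n ∈ Finset.Ico (L + 1) (L + N + 1), z ^ n‖ * ‖z - 1‖ ≤ 2 := by
    rw [← norm_mul, hgeom]
    refine (norm_sub_le _ _).trans ?_
    simp only [norm_pow, hz1, one_pow]
    norm_num
  rw [hsum, le_div_iff₀ ha0]
  have h := (mul_le_mul_of_nonneg_left hlow (norm_nonneg _)).trans hub
  rw [← mul_div_assoc, div_le_iff₀ hp] at h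
  linarith [mul_nonneg (norm_nonneg (∑ n ∈ Finset.Ico (L + 1) (L + N + 1), z ^ n)) ha0.le]

section CenteredResidues

variable {p : ℕ} [Fact p.Prime]

/-- The quotient `k` in the relation `a * b = 1 + k * p`, where `a` and `b` are the least absolute
residues of `x` and `x⁻¹`. -/
def invQuot (x : ZMod p) : ℤ := (x.valMinAbs * x⁻¹.valMinAbs - 1) / p

theorem valMinAbs_mul_valMinAbs_inv {x : ZMod p} (hx : x ≠ 0) :
    x.valMinAbs * x⁻¹.valMinAbs = 1 + invQuot x * p := by
  have h : (p : ℤ) ∣ x.valMinAbs * x⁻¹.valMinAbs - 1 := by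
    rw [← ZMod.intCast_zmod_eq_zero_iff_dvd]
    push_cast
    simp [mul_inv_cancel₀ hx]
  rw [invQuot, Int.ediv_mul_cancel h]
  ring

theorem natAbs_invQuot_le {x : ZMod p} (hx : x ≠ 0) : (invQuot x).natAbs ≤ p := by
  have hp : 2 ≤ p := (Fact.out : p.Prime).two_le
  have h := valMinAbs_mul_valMinAbs_inv hx
  have h1 := ZMod.natAbs_valMinAbs_le x
  have h2 := ZMod.natAbs_valMinAbs_le x⁻¹
  have h3 : (x.valMinAbs * x⁻¹.valMinAbs).natAbs ≤ p * (p / 2) := by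
    rw [Int.natAbs_mul]
    exact Nat.mul_le_mul (by omega) h2
  have h4 : (invQuot x).natAbs * p ≤ p * (p / 2) + 1 := by
    have : invQuot x * p = x.valMinAbs * x⁻¹.valMinAbs - 1 := by rw [h]; ring
    calc (invQuot x).natAbs * p = (invQuot x * p).natAbs := by simp [Int.natAbs_mul]
      _ ≤ _ := by rw [this]; omega
  have h5 : p / 2 + 1 ≤ p := by omega
  nlinarith

theorem eq_one_or_eq_neg_one_of_invQuot_eq_zero {x : ZMod p} (hx : x ≠ 0) (h : invQuot x = 0) :
    x = 1 ∨ x = -1 := by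
  have h1 := valMinAbs_mul_valMinAbs_inv hx
  rw [h, zero_mul, add_zero] at h1
  rw [← ZMod.coe_valMinAbs x]
  rcases Int.eq_one_or_neg_one_of_mul_eq_one h1 with h2 | h2 <;> simp [h2]

theorem mul_natAbs_invQuot_le {x : ZMod p} (hx : x ≠ 0) (h : invQuot x ≠ 0) :
    (p : ℝ) * (invQuot x).natAbs ≤
      2 * (|(x.valMinAbs : ℝ)| * |(x⁻¹.valMinAbs : ℝ)|) := by
  have hp : 2 ≤ p := (Fact.out : p.Prime).two_le
  have h1 : p * (invQuot x).natAbs ≤ 2 * (x.valMinAbs * x⁻¹.valMinAbs).natAbs := by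
    rw [valMinAbs_mul_valMinAbs_inv hx]
    have h2 : (invQuot x * p).natAbs = p * (invQuot x).natAbs := by
      simp [Int.natAbs_mul, mul_comm]
    have h3 : 2 * 1 ≤ p * (invQuot x).natAbs :=
      Nat.mul_le_mul hp (Int.natAbs_pos.2 h)
    omega
  have h2 : ((p * (invQuot x).natAbs : ℕ) : ℝ) ≤
      ((2 * (x.valMinAbs * x⁻¹.valMinAbs).natAbs : ℕ) : ℝ) := by exact_mod_cast h1
  rw [Int.natAbs_mul] at h2
  push_cast [Nat.cast_natAbs] at h2 ⊢
  exact h2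

/-- The number of `x` with a given `|k|` in `a * b = 1 + k * p` is controlled by the divisor
function at `|k| * p ± 1`. -/
theorem card_filter_natAbs_invQuot_le {j : ℕ} (hj : j ≠ 0) :
    (Finset.univ.filter fun x : ZMod p => x ≠ 0 ∧ (invQuot x).natAbs = j).card ≤
      2 * ((j * p + 1).divisors.card + (j * p - 1).divisors.card) := by
  classical
  set D := (j * p + 1).divisors ∪ (j * p - 1).divisors with hD
  have hjp : 2 ≤ j * p := by
    have := Nat.mul_le_mul (Nat.one_le_iff_ne_zero.2 hj) (Fact.out : p.Prime).two_le
    omega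
  set E : Finset ℤ := D.image (fun d : ℕ => (d : ℤ)) ∪ D.image (fun d : ℕ => -(d : ℤ)) with hE
  calc _ ≤ E.card := by
        refine Finset.card_le_card_of_injOn ZMod.valMinAbs (fun x hx => ?_)
          (fun x _ y _ h => ZMod.injective_valMinAbs h)
        simp only [Finset.coe_filter, Finset.mem_univ, true_and, Set.mem_ofPred_eq] at hx
        have hmem : x.valMinAbs.natAbs ∈ D := by
          have h1 := valMinAbs_mul_valMinAbs_inv hx.1
          have h2 : x.valMinAbs.natAbs ∣ (1 + invQuot x * p).natAbs := by
            rw [← h1, Int.natAbs_mul]; exact dvd_mul_right _ _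
          have h3 : (invQuot x * p).natAbs = j * p := by rw [Int.natAbs_mul, hx.2]; simp
          have h4 : (1 + invQuot x * p).natAbs = j * p + 1 ∨
              (1 + invQuot x * p).natAbs = j * p - 1 := by omega
          rw [hD, Finset.mem_union, Nat.mem_divisors, Nat.mem_divisors]
          rcases h4 with h4 | h4
          · exact Or.inl ⟨h4 ▸ h2, by omega⟩
          · exact Or.inr ⟨h4 ▸ h2, by omega⟩
        rw [hE, Finset.mem_coe, Finset.mem_union, Finset.mem_image, Finset.mem_image]
        rcases Int.natAbs_eq x.valMinAbs with h | h
        · exact Or.inl ⟨_, hmem, h.symm⟩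
        · exact Or.inr ⟨_, hmem, h.symm⟩
    _ ≤ D.card + D.card := (Finset.card_union_le _ _).trans
        (add_le_add Finset.card_image_le Finset.card_image_le)
    _ ≤ _ := by
        rw [← two_mul]
        exact Nat.mul_le_mul_left _ (Finset.card_union_le _ _)

end CenteredResidues

theorem sum_Icc_inv_le (n : ℕ) : ∑ j ∈ Finset.Icc 1 n, ((j : ℝ))⁻¹ ≤ 1 + Real.log n := by
  have h := harmonic_le_one_add_log n
  rw [harmonic_eq_sum_Icc] at h
  push_cast at h
  exact h

theorem ep_eq_stdAddChar {p : ℕ} [NeZero p] (z : ℤ) : ep p z = ZMod.stdAddChar (z : ZMod p) := by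
  rw [ZMod.stdAddChar_coe, ep]

theorem Kl_eq_sum {p : ℕ} [Fact p.Prime] (m n : ℤ) :
    Kl p m n = ∑ x ∈ Finset.univ.erase (0 : ZMod p),
      ZMod.stdAddChar ((m : ZMod p) * x + (n : ZMod p) * x⁻¹) := by
  have hp := (Fact.out : p.Prime).two_le
  rw [Kl]
  refine Finset.sum_bij' (fun x _ => (x : ZMod p)) (fun x _ => x.val) ?_ ?_ ?_ ?_ ?_
  · intro x hx
    rw [Finset.mem_Icc] at hx
    simp only [Finset.mem_erase, Finset.mem_univ, and_true, ne_eq, ZMod.natCast_eq_zero_iff]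
    exact Nat.not_dvd_of_pos_of_lt (by omega) (by omega)
  · intro x hx
    have h1 := ZMod.val_lt x
    have h2 : x.val ≠ 0 := by simpa using hx
    rw [Finset.mem_Icc]
    omega
  · intro x hx
    rw [Finset.mem_Icc] at hx
    exact ZMod.val_cast_of_lt (by omega)
  · intro x _
    exact ZMod.natCast_zmod_val x
  · intro x _
    rw [ep_eq_stdAddChar]
    simp [pinv]

/-- Scaling the summation variable moves a factor from one argument to the other. -/
theorem Kl_mul_one {p : ℕ} [Fact p.Prime] (m n : ℤ) (hm : (m : ZMod p) ≠ 0) :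
    Kl p (m * n) 1 =
      ∑ x ∈ Finset.univ.erase (0 : ZMod p), ZMod.stdAddChar ((n : ZMod p) * x + (m : ZMod p) * x⁻¹) := by
  rw [Kl_eq_sum]
  refine Finset.sum_bij' (fun x _ => (m : ZMod p) * x) (fun x _ => (m : ZMod p)⁻¹ * x)
    ?_ ?_ ?_ ?_ ?_
  · intro x hx
    simpa [hm] using hx
  · intro x hx
    simpa [hm] using hx
  · intro x _
    exact inv_mul_cancel_left₀ hm x
  · intro x _
    exact mul_inv_cancel_left₀ hm x
  · intro x _
    congr 1
    rw [mul_inv, mul_inv_cancel_left₀ hm]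
    push_cast
    ring

theorem sum_sum_Kl_eq {p : ℕ} [Fact p.Prime] (K L M N : ℕ) (hK : K + M ≤ p - 1) :
    ∑ m ∈ Finset.Icc (K + 1) (K + M), ∑ n ∈ Finset.Icc (L + 1) (L + N), Kl p ((m : ℤ) * n) 1 =
      ∑ x ∈ Finset.univ.erase (0 : ZMod p),
        (∑ n ∈ Finset.Icc (L + 1) (L + N), ZMod.stdAddChar ((n : ZMod p) * x)) *
        (∑ m ∈ Finset.Icc (K + 1) (K + M), ZMod.stdAddChar ((m : ZMod p) * x⁻¹)) := by
  have hp := (Fact.out : p.Prime).two_le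
  have h : ∀ m ∈ Finset.Icc (K + 1) (K + M), ∀ n ∈ Finset.Icc (L + 1) (L + N),
      Kl p ((m : ℤ) * n) 1 = ∑ x ∈ Finset.univ.erase (0 : ZMod p),
        ZMod.stdAddChar ((n : ZMod p) * x) * ZMod.stdAddChar ((m : ZMod p) * x⁻¹) := by
    intro m hm n _
    rw [Finset.mem_Icc] at hm
    rw [Kl_mul_one]
    · simp [AddChar.map_add_eq_mul]
    · rw [Int.cast_natCast, ne_eq, ZMod.natCast_eq_zero_iff]
      exact Nat.not_dvd_of_pos_of_lt (by omega) (by omega)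
  rw [Finset.sum_congr rfl fun m hm => Finset.sum_congr rfl (h m hm),
    Finset.sum_congr rfl fun m _ => Finset.sum_comm, Finset.sum_comm]
  refine Finset.sum_congr rfl fun x _ => ?_
  rw [Finset.sum_comm, Finset.sum_mul_sum]

theorem norm_sum_stdAddChar_le_card {p : ℕ} [NeZero p] (x : ZMod p) (L N : ℕ) :
    ‖∑ n ∈ Finset.Icc (L + 1) (L + N), ZMod.stdAddChar ((n : ZMod p) * x)‖ ≤ N := by
  refine (norm_sum_le _ _).trans ?_
  simp [AddChar.norm_apply]

/-- For `x ≠ ±1` the product of the two incomplete sums is `O(p / |k|)`. -/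
theorem norm_sum_mul_sum_le {p : ℕ} [Fact p.Prime] (K L M N : ℕ) {x : ZMod p} (hx : x ≠ 0)
    (hk : invQuot x ≠ 0) :
    ‖(∑ n ∈ Finset.Icc (L + 1) (L + N), ZMod.stdAddChar ((n : ZMod p) * x)) *
      (∑ m ∈ Finset.Icc (K + 1) (K + M), ZMod.stdAddChar ((m : ZMod p) * x⁻¹))‖ ≤
      2 * p * ((invQuot x).natAbs : ℝ)⁻¹ := by
  have hp : (0 : ℝ) < p := by exact_mod_cast (Fact.out : p.Prime).pos
  have ha : 0 < |(x.valMinAbs : ℝ)| := by simpa using hx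
  have hb : 0 < |(x⁻¹.valMinAbs : ℝ)| := by simpa using hx
  have hj : (0 : ℝ) < (invQuot x).natAbs := by exact_mod_cast Int.natAbs_pos.2 hk
  rw [norm_mul]
  calc _ ≤ p / |(x.valMinAbs : ℝ)| * (p / |(x⁻¹.valMinAbs : ℝ)|) := by
        gcongr
        · exact norm_sum_stdAddChar_le x hx L N
        · exact norm_sum_stdAddChar_le x⁻¹ (inv_ne_zero hx) K M
    _ ≤ _ := by
      rw [div_mul_div_comm, ← div_eq_mul_inv, div_le_div_iff₀ (by positivity) hj]
      have := mul_le_mul_of_nonneg_left (mul_natAbs_invQuot_le hx hk) hp.le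
      linarith

theorem norm_sum_erase_le {p : ℕ} [Fact p.Prime] (K L M N : ℕ) {D : ℝ} (hD0 : 0 ≤ D)
    (hD : ∀ n : ℕ, n ≠ 0 → n ≤ 2 * p ^ 2 → (n.divisors.card : ℝ) ≤ D) :
    ‖∑ x ∈ Finset.univ.erase (0 : ZMod p),
        (∑ n ∈ Finset.Icc (L + 1) (L + N), ZMod.stdAddChar ((n : ZMod p) * x)) *
        (∑ m ∈ Finset.Icc (K + 1) (K + M), ZMod.stdAddChar ((m : ZMod p) * x⁻¹))‖ ≤
      2 * (M * N) + 8 * p * D * (1 + Real.log p) := by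
  classical
  have hp2 := (Fact.out : p.Prime).two_le
  set F : ZMod p → ℂ := fun x =>
    (∑ n ∈ Finset.Icc (L + 1) (L + N), ZMod.stdAddChar ((n : ZMod p) * x)) *
    (∑ m ∈ Finset.Icc (K + 1) (K + M), ZMod.stdAddChar ((m : ZMod p) * x⁻¹)) with hF
  have hFle : ∀ x, ‖F x‖ ≤ M * N := fun x => by
    rw [hF, norm_mul, mul_comm (M : ℝ)]
    gcongr
    · exact norm_sum_stdAddChar_le_card x L N
    · exact norm_sum_stdAddChar_le_card x⁻¹ K M
  have hmaps : ∀ x ∈ Finset.univ.erase (0 : ZMod p),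
      (invQuot x).natAbs ∈ insert 0 (Finset.Icc 1 p) := fun x hx => by
    have := natAbs_invQuot_le (Finset.ne_of_mem_erase hx)
    rw [Finset.mem_insert, Finset.mem_Icc]
    omega
  have hzero : ∑ x ∈ Finset.univ.erase (0 : ZMod p) with (invQuot x).natAbs = 0, ‖F x‖ ≤
      2 * (M * N) := by
    calc _ ≤ ∑ x ∈ ({1, -1} : Finset (ZMod p)), ‖F x‖ := by
          refine Finset.sum_le_sum_of_subset_of_nonneg (fun x hx => ?_) fun _ _ _ => norm_nonneg _
          simp only [Finset.mem_filter, Finset.mem_erase, Finset.mem_univ, and_true,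
            Int.natAbs_eq_zero] at hx
          simpa using eq_one_or_eq_neg_one_of_invQuot_eq_zero hx.1 hx.2
      _ ≤ ({1, -1} : Finset (ZMod p)).card • ((M : ℝ) * N) :=
          Finset.sum_le_card_nsmul _ _ _ fun x _ => hFle x
      _ ≤ _ := by
          rw [nsmul_eq_mul]
          gcongr
          exact_mod_cast Finset.card_le_two
  have hpos : ∀ j ∈ Finset.Icc 1 p,
      ∑ x ∈ Finset.univ.erase (0 : ZMod p) with (invQuot x).natAbs = j, ‖F x‖ ≤
        8 * p * D * (j : ℝ)⁻¹ := by
    intro j hj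
    rw [Finset.mem_Icc] at hj
    have hset : (Finset.univ.erase (0 : ZMod p)).filter (fun x => (invQuot x).natAbs = j) =
        Finset.univ.filter fun x : ZMod p => x ≠ 0 ∧ (invQuot x).natAbs = j := by
      ext; simp
    have hjp : j * p ≤ p ^ 2 := by rw [sq]; exact Nat.mul_le_mul hj.2 le_rfl
    have hjp2 : 1 * 2 ≤ j * p := Nat.mul_le_mul hj.1 hp2
    have hcard : ((Finset.univ.filter fun x : ZMod p => x ≠ 0 ∧ (invQuot x).natAbs = j).card : ℝ)
        ≤ 4 * D := by
      have h1 := card_filter_natAbs_invQuot_le (p := p) (j := j) (by omega)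
      have h2 := hD (j * p + 1) (by omega) (by omega)
      have h3 := hD (j * p - 1) (by omega) (by omega)
      have h4 : ((Finset.univ.filter fun x : ZMod p => x ≠ 0 ∧ (invQuot x).natAbs = j).card : ℝ) ≤
        2 * ((j * p + 1).divisors.card + (j * p - 1).divisors.card) := by exact_mod_cast h1
      linarith
    rw [hset]
    calc _ ≤ _ • (2 * p * (j : ℝ)⁻¹) := Finset.sum_le_card_nsmul _ _ _ fun x hx => by
          obtain ⟨hx0, hxj⟩ := (Finset.mem_filter.1 hx).2
          rw [← hxj]
          exact norm_sum_mul_sum_le K L M N hx0 (by omega)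
      _ ≤ 4 * D * (2 * p * (j : ℝ)⁻¹) := by rw [nsmul_eq_mul]; gcongr
      _ = _ := by ring
  calc _ ≤ ∑ x ∈ Finset.univ.erase (0 : ZMod p), ‖F x‖ := norm_sum_le _ _
    _ = ∑ j ∈ insert 0 (Finset.Icc 1 p),
        ∑ x ∈ Finset.univ.erase (0 : ZMod p) with (invQuot x).natAbs = j, ‖F x‖ :=
        (Finset.sum_fiberwise_of_maps_to hmaps _).symm
    _ ≤ 2 * (M * N) + ∑ j ∈ Finset.Icc 1 p, 8 * p * D * (j : ℝ)⁻¹ := by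
        rw [Finset.sum_insert (by simp)]
        exact add_le_add hzero (Finset.sum_le_sum hpos)
    _ ≤ _ := by
        rw [← Finset.mul_sum]
        gcongr
        exact sum_Icc_inv_le p

theorem cancellation_bilinear_Kloosterman :
    ∀ ε : ℝ, 0 < ε → ∃ C : ℝ, 0 < C ∧
      ∀ p K L M N : ℕ, p.Prime → 1 ≤ K → 1 ≤ L → 1 ≤ M → 1 ≤ N →
        K + M ≤ p - 1 → L + N ≤ p - 1 →
        ‖∑ m ∈ Finset.Icc (K + 1) (K + M), ∑ n ∈ Finset.Icc (L + 1) (L + N),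
            Kl p ((m : ℤ) * n) 1‖ ≤ C * ((p : ℝ) + (M : ℝ) * N) * (p : ℝ) ^ ε := by
  intro ε hε
  obtain ⟨C, hC, hdiv⟩ := exists_card_divisors_le_mul_rpow (ε := ε / 6) (by positivity)
  refine ⟨2 + 8 * C * (1 + 2 / ε), by positivity, fun p K L M N hp _ _ _ _ hK _ => ?_⟩
  have : Fact p.Prime := ⟨hp⟩
  have hp2 : (2 : ℝ) ≤ p := by exact_mod_cast hp.two_le
  have hp0 : (0 : ℝ) < p := by linarith
  have hD : ∀ n : ℕ, n ≠ 0 → n ≤ 2 * p ^ 2 →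
      (n.divisors.card : ℝ) ≤ C * (p : ℝ) ^ (ε / 2) := by
    intro n hn hnp
    refine (hdiv n hn).trans ?_
    have h1 : (n : ℝ) ≤ (p : ℝ) ^ (3 : ℕ) := by
      have : (n : ℝ) ≤ 2 * p ^ 2 := by exact_mod_cast hnp
      nlinarith [sq_nonneg (p : ℝ)]
    calc C * (n : ℝ) ^ (ε / 6) ≤ C * ((p : ℝ) ^ (3 : ℕ)) ^ (ε / 6) := by gcongr
      _ = C * (p : ℝ) ^ (ε / 2) := by
        rw [← Real.rpow_natCast, ← Real.rpow_mul hp0.le]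
        congr 2
        push_cast
        ring
  have hhalf : 1 ≤ (p : ℝ) ^ (ε / 2) := Real.one_le_rpow (by linarith) (by positivity)
  have hsq : (p : ℝ) ^ (ε / 2) * (p : ℝ) ^ (ε / 2) = (p : ℝ) ^ ε := by
    rw [← Real.rpow_add hp0]; congr 1; ring
  have hone : 1 ≤ (p : ℝ) ^ ε := Real.one_le_rpow (by linarith) hε.le
  have hlog : 1 + Real.log p ≤ (1 + 2 / ε) * (p : ℝ) ^ (ε / 2) := by
    have := Real.log_le_rpow_div hp0.le (show 0 < ε / 2 by positivity)
    calc 1 + Real.log p ≤ (p : ℝ) ^ (ε / 2) + (p : ℝ) ^ (ε / 2) / (ε / 2) := add_le_add hhalf this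
      _ = _ := by field_simp
  rw [sum_sum_Kl_eq K L M N hK]
  refine (norm_sum_erase_le K L M N (by positivity) hD).trans ?_
  set A := 8 * C * (1 + 2 / ε) with hA
  have hA0 : 0 ≤ A := by positivity
  calc 2 * ((M : ℝ) * N) + 8 * p * (C * (p : ℝ) ^ (ε / 2)) * (1 + Real.log p)
      ≤ 2 * ((M : ℝ) * N) * (p : ℝ) ^ ε +
        8 * p * (C * (p : ℝ) ^ (ε / 2)) * ((1 + 2 / ε) * (p : ℝ) ^ (ε / 2)) := by
        refine add_le_add (le_mul_of_one_le_right (by positivity) hone) ?_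
        gcongr
    _ = (2 * (M * N) + A * p) * (p : ℝ) ^ ε := by rw [← hsq, hA]; ring
    _ ≤ (2 + A) * (p + M * N) * (p : ℝ) ^ ε := by
        gcongr
        have : 0 ≤ A * ((M : ℝ) * N) := by positivity
        nlinarith
end

section
/- For every ε > 0 there exists a constant C > 0 such that for every prime p and all integers M, N with 1 ≤ M, N < p, the number of integers x with 1 ≤ x ≤ p-1, ‖x‖_p ≤ p/M and ‖x̄‖_p ≤ p/N is at most C (p/(MN) + 1) p^ε. -/
/-- `‖u‖_p`: the distance from `u` to the nearest multiple of `p` -/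
def dp (p : ℕ) (u : ℤ) : ℕ := min (u % p).toNat (p - (u % p).toNat)

theorem natCast_add_one_le_mul_rpow {δ : ℝ} (hδ : 0 < δ) {q : ℕ} (hq : 2 ≤ q) (v : ℕ) :
    (v : ℝ) + 1 ≤ (1 + 1 / (δ * Real.log 2)) * ((q : ℝ) ^ v) ^ δ := by
  have hc : 0 < δ * Real.log 2 := mul_pos hδ (Real.log_pos (by norm_num))
  have hexp : (v : ℝ) * (δ * Real.log 2) + 1 ≤ ((q : ℝ) ^ v) ^ δ := by
    calc (v : ℝ) * (δ * Real.log 2) + 1 ≤ Real.exp (v * (δ * Real.log 2)) := Real.add_one_le_exp _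
      _ = ((2 : ℝ) ^ v) ^ δ := by
        rw [Real.rpow_def_of_pos (by positivity), Real.log_pow]
        congr 1
        ring
      _ ≤ ((q : ℝ) ^ v) ^ δ := by
        have : (2 : ℝ) ≤ q := by exact_mod_cast hq
        gcongr
  calc (v : ℝ) + 1 ≤ (1 + 1 / (δ * Real.log 2)) * (v * (δ * Real.log 2) + 1) := by
        have h : (1 + 1 / (δ * Real.log 2)) * (v * (δ * Real.log 2) + 1)
            = v + 1 + (v * (δ * Real.log 2) + 1 / (δ * Real.log 2)) := by
          field_simp
          ring
        rw [h]
        have : 0 ≤ (v : ℝ) * (δ * Real.log 2) + 1 / (δ * Real.log 2) := by positivity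
        linarith
    _ ≤ _ := by gcongr

theorem natCast_add_one_le_rpow {δ : ℝ} {q : ℕ} (hq : 2 ≤ (q : ℝ) ^ δ) (v : ℕ) :
    (v : ℝ) + 1 ≤ ((q : ℝ) ^ v) ^ δ := by
  calc (v : ℝ) + 1 ≤ 2 ^ v := by exact_mod_cast Nat.lt_two_pow_self
    _ ≤ ((q : ℝ) ^ δ) ^ v := by gcongr
    _ = ((q : ℝ) ^ v) ^ δ := by
      rw [← Real.rpow_natCast, ← Real.rpow_natCast, ← Real.rpow_mul (by positivity),
        ← Real.rpow_mul (by positivity), mul_comm]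

/-- The divisor bound: the number of divisors of `n` is `O(n ^ δ)` for every `δ > 0`. -/
theorem exists_card_divisors_le_rpow {δ : ℝ} (hδ : 0 < δ) :
    ∃ C : ℝ, 0 < C ∧ ∀ n : ℕ, n ≠ 0 → (n.divisors.card : ℝ) ≤ C * (n : ℝ) ^ δ := by
  have hc : 0 < δ * Real.log 2 := mul_pos hδ (Real.log_pos (by norm_num))
  set A : ℝ := 1 + 1 / (δ * Real.log 2) with hA
  have hA1 : 1 ≤ A := by
    have : 0 < 1 / (δ * Real.log 2) := by positivity
    linarith
  set B : ℕ := ⌈(2 : ℝ) ^ (1 / δ)⌉₊ with hB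
  have hlarge : ∀ q : ℕ, B ≤ q → 2 ≤ (q : ℝ) ^ δ := by
    intro q hq
    have h1 : (2 : ℝ) ^ (1 / δ) ≤ q := Nat.ceil_le.mp hq
    calc (2 : ℝ) = ((2 : ℝ) ^ (1 / δ)) ^ δ := by
          rw [← Real.rpow_mul (by norm_num), one_div_mul_cancel hδ.ne', Real.rpow_one]
      _ ≤ _ := by gcongr
  refine ⟨A ^ B, by positivity, fun n hn => ?_⟩
  rw [Nat.card_divisors hn]
  push_cast
  have hprod : (n : ℝ) ^ δ = ∏ q ∈ n.primeFactors, ((q : ℝ) ^ n.factorization q) ^ δ := by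
    rw [Real.finsetProd_rpow _ _ (fun i _ => by positivity)]
    congr 1
    exact_mod_cast (Nat.prod_factorization_pow_eq_self hn).symm
  calc ∏ q ∈ n.primeFactors, ((n.factorization q : ℝ) + 1)
      ≤ ∏ q ∈ n.primeFactors,
          ((if q < B then A else 1) * ((q : ℝ) ^ n.factorization q) ^ δ) := by
        refine Finset.prod_le_prod (fun _ _ => by positivity) fun q hq => ?_
        split_ifs with h
        · exact natCast_add_one_le_mul_rpow hδ (Nat.prime_of_mem_primeFactors hq).two_le _
        · rw [one_mul]
          exact natCast_add_one_le_rpow (hlarge q (not_lt.mp h)) _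
    _ = A ^ (n.primeFactors.filter (· < B)).card * (n : ℝ) ^ δ := by
        rw [Finset.prod_mul_distrib, ← hprod, ← Finset.prod_filter, Finset.prod_const]
    _ ≤ A ^ B * (n : ℝ) ^ δ := by
        gcongr
        calc _ ≤ (Finset.range B).card := Finset.card_le_card fun q hq => by
              simpa using (Finset.mem_filter.mp hq).2
          _ = B := Finset.card_range B

theorem dp_natCast_of_lt {p u : ℕ} (hu : u < p) : dp p u = min u (p - u) := by
  have h : (u : ℤ) % p = u := Int.emod_eq_of_lt (by positivity) (by exact_mod_cast hu)
  simp [dp, h]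

theorem natCast_dp_eq_or_eq_neg {p u : ℕ} (hu : u < p) :
    (dp p u : ZMod p) = u ∨ (dp p u : ZMod p) = -u := by
  rw [dp_natCast_of_lt hu]
  rcases min_choice u (p - u) with h | h <;> rw [h]
  · exact Or.inl rfl
  · right
    rw [Nat.cast_sub hu.le]
    simp

theorem dp_mul_dp_pinv {p x : ℕ} (hp : p.Prime) (hx : x ∈ Finset.Icc 1 (p - 1)) :
    ((dp p x * dp p (pinv p x) : ℕ) : ZMod p) = 1 ∨
      ((dp p x * dp p (pinv p x) : ℕ) : ZMod p) = -1 := by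
  have := Fact.mk hp
  obtain ⟨h1, h2⟩ := Finset.mem_Icc.mp hx
  have hxp : x < p := by have := hp.pos; omega
  have hx0 : (x : ZMod p) ≠ 0 := by
    rw [Ne, ZMod.natCast_eq_zero_iff]
    exact Nat.not_dvd_of_pos_of_lt h1 hxp
  have hinv : ((pinv p x : ℕ) : ZMod p) = (x : ZMod p)⁻¹ := ZMod.natCast_zmod_val _
  have hlt : pinv p x < p := ZMod.val_lt _
  push_cast
  rcases natCast_dp_eq_or_eq_neg hxp with h | h <;>
    rcases natCast_dp_eq_or_eq_neg hlt with h' | h' <;>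
      rw [h, h', hinv] <;> simp [hx0]

/-- The positive integers at most `p ^ 2` of the form `p * k + 1` with `k ≤ K` or `p * k - 1`
with `k ≤ K + 1`. -/
def nearMultiples (p K : ℕ) : Finset ℕ :=
  ((Finset.range (K + 1)).image (fun k => p * k + 1) ∪
    (Finset.range (K + 2)).image (fun k => p * k - 1)).filter (fun m => m ≠ 0 ∧ m ≤ p ^ 2)

theorem card_nearMultiples_le (p K : ℕ) : (nearMultiples p K).card ≤ 2 * K + 3 := by
  refine (Finset.card_filter_le _ _).trans ((Finset.card_union_le _ _).trans ?_)
  have h1 := Finset.card_image_le (s := Finset.range (K + 1)) (f := fun k => p * k + 1)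
  have h2 := Finset.card_image_le (s := Finset.range (K + 2)) (f := fun k => p * k - 1)
  rw [Finset.card_range] at h1 h2
  omega

theorem mem_nearMultiples {p L m : ℕ} (hp : 1 < p) (hL : 0 < L) (hm : L * m ≤ p ^ 2)
    (h : (m : ZMod p) = 1 ∨ (m : ZMod p) = -1) : m ∈ nearMultiples p (p / L) := by
  have : Fact (1 < p) := ⟨hp⟩
  have hm0 : m ≠ 0 := by
    rintro rfl
    rcases h with h | h <;> simp at h
  have hle : m ≤ p ^ 2 := (Nat.le_mul_of_pos_left m hL).trans hm
  have key : ∀ k, p * k ≤ m → k ≤ p / L := fun k hk => by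
    rw [Nat.le_div_iff_mul_le hL]
    refine Nat.le_of_mul_le_mul_left (c := p) ?_ (by omega)
    calc p * (k * L) = L * (p * k) := by ring
      _ ≤ L * m := Nat.mul_le_mul_left _ hk
      _ ≤ p * p := by rwa [← sq]
  refine Finset.mem_filter.mpr ⟨Finset.mem_union.mpr ?_, hm0, hle⟩
  rcases h with h | h
  · have hd : p ∣ m - 1 := by
      rw [← ZMod.natCast_eq_zero_iff, Nat.cast_sub (by omega), h]
      simp
    obtain ⟨k, hk⟩ := hd
    refine Or.inl (Finset.mem_image.mpr ⟨k, ?_, by omega⟩)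
    rw [Finset.mem_range, Nat.lt_succ_iff]
    exact key k (by omega)
  · have hd : p ∣ m + 1 := by
      rw [← ZMod.natCast_eq_zero_iff, Nat.cast_add, h]
      simp
    obtain ⟨k, hk⟩ := hd
    refine Or.inr (Finset.mem_image.mpr ⟨k, ?_, by omega⟩)
    rw [Finset.mem_range]
    have := key (k - 1) (by
      rw [Nat.mul_sub, mul_one]
      omega)
    omega

theorem count_small_x_and_small_inverse :
    ∀ ε : ℝ, 0 < ε → ∃ C : ℝ, 0 < C ∧
      ∀ p M N : ℕ, p.Prime → 1 ≤ M → M < p → 1 ≤ N → N < p →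
        ((((Finset.Icc 1 (p - 1)).filter
            (fun x : ℕ => (M * dp p x : ℝ) ≤ p ∧ (N * dp p (pinv p x) : ℝ) ≤ p)).card : ℝ)) ≤
          C * ((p : ℝ) / ((M : ℝ) * N) + 1) * (p : ℝ) ^ ε := by
  intro ε hε
  obtain ⟨C, hC, hdiv⟩ := exists_card_divisors_le_rpow (half_pos hε)
  refine ⟨6 * C, by positivity, fun p M N hp hM _ hN _ => ?_⟩
  set S := (Finset.Icc 1 (p - 1)).filter
    (fun x : ℕ => (M * dp p x : ℝ) ≤ p ∧ (N * dp p (pinv p x) : ℝ) ≤ p) with hS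
  set T := nearMultiples p (p / (M * N)) with hT
  have hsub : S ⊆ T.biUnion fun m => m.divisors.biUnion fun a => {a, p - a} := by
    intro x hx
    obtain ⟨hxI, hx1, hx2⟩ := Finset.mem_filter.mp hx
    norm_cast at hx1 hx2
    have hmem : dp p x * dp p (pinv p x) ∈ T := by
      refine mem_nearMultiples hp.one_lt (Nat.mul_pos hM hN) ?_ (dp_mul_dp_pinv hp hxI)
      calc M * N * (dp p x * dp p (pinv p x)) = (M * dp p x) * (N * dp p (pinv p x)) := by ring
        _ ≤ p * p := Nat.mul_le_mul hx1 hx2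
        _ = p ^ 2 := (sq p).symm
    refine Finset.mem_biUnion.mpr ⟨_, hmem, Finset.mem_biUnion.mpr ⟨dp p x, ?_, ?_⟩⟩
    · exact Nat.mem_divisors.mpr ⟨dvd_mul_right _ _, (Finset.mem_filter.mp hmem).2.1⟩
    · have hI := Finset.mem_Icc.mp hxI
      rw [dp_natCast_of_lt (show x < p by omega)]
      rw [Finset.mem_insert, Finset.mem_singleton]
      omega
  have hcard : S.card ≤ ∑ m ∈ T, m.divisors.card * 2 :=
    (Finset.card_le_card hsub).trans <| Finset.card_biUnion_le.trans <|
      Finset.sum_le_sum fun m _ => Finset.card_biUnion_le_card_mul _ _ _ fun a _ =>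
        Finset.card_le_two
  have hterm : ∀ m ∈ T, ((m.divisors.card * 2 : ℕ) : ℝ) ≤ 2 * C * (p : ℝ) ^ ε := by
    intro m hm
    obtain ⟨-, hm0, hmp⟩ := Finset.mem_filter.mp hm
    have hmp' : (m : ℝ) ≤ (p : ℝ) ^ 2 := by exact_mod_cast hmp
    have hpow : (m : ℝ) ^ (ε / 2) ≤ (p : ℝ) ^ ε := by
      calc (m : ℝ) ^ (ε / 2) ≤ ((p : ℝ) ^ 2) ^ (ε / 2) := by gcongr
        _ = (p : ℝ) ^ ε := by
          rw [← Real.rpow_natCast, ← Real.rpow_mul (by positivity)]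
          congr 1
          push_cast
          ring
    have := (hdiv m hm0).trans (mul_le_mul_of_nonneg_left hpow hC.le)
    push_cast
    linarith
  have hquot : ((p / (M * N) : ℕ) : ℝ) ≤ (p : ℝ) / ((M : ℝ) * N) := by
    simpa using Nat.cast_div_le (α := ℝ) (m := p) (n := M * N)
  have hTcard : (T.card : ℝ) ≤ 3 * ((p : ℝ) / ((M : ℝ) * N) + 1) := by
    have h : (T.card : ℝ) ≤ 2 * ((p / (M * N) : ℕ) : ℝ) + 3 := by
      exact_mod_cast card_nearMultiples_le p (p / (M * N))
    have : 0 ≤ (p : ℝ) / ((M : ℝ) * N) := by positivity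
    linarith
  calc (S.card : ℝ) ≤ ∑ m ∈ T, ((m.divisors.card * 2 : ℕ) : ℝ) := by exact_mod_cast hcard
    _ ≤ T.card • (2 * C * (p : ℝ) ^ ε) := Finset.sum_le_card_nsmul _ _ _ hterm
    _ = T.card * (2 * C * (p : ℝ) ^ ε) := nsmul_eq_mul _ _
    _ ≤ 3 * ((p : ℝ) / ((M : ℝ) * N) + 1) * (2 * C * (p : ℝ) ^ ε) := by gcongr
    _ = _ := by ring
end
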